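/- Let G be a finite group, let φ : G → ℂ be a class function (i.e., φ(aba⁻¹) = φ(b) for all a, b ∈ G), and let 1 ≤ k ≤ n be integers. Then the element z := Σ φ(g_k ⋯ g₁) · g₁^{(i₁)} ⋯ g_k^{(i_k)} · (i₁,…,i_k) of the group algebra ℂ[G(n)], where the sum ranges over all ordered k-tuples of pairwise distinct indices i₁,…,i_k ∈ {1,…,n} and all k-tuples g₁,…,g_k ∈ G, lies in the center of ℂ[G(n)]. In particular, for an irreducible character ψ of G, the element z_n^{(k,ψ)} := (dim ψ / |G|)^k · Σ ψ̄(g_k ⋯ g₁) · g₁^{(i₁)} ⋯ g_k^{(i_k)} · (i₁,…,i_k) is central in ℂ[G(n)]. -/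

import Mathlib

/-- The action of `S(n)` on `Gⁿ` by permutation of the coordinates:
`σ` sends `f` to `f ∘ σ⁻¹`. -/
def permAction (G : Type*) [Group G] (n : ℕ) :
    Equiv.Perm (Fin n) →* MulAut (Fin n → G) where
  toFun σ :=
    { toEquiv := Equiv.arrowCongr σ (Equiv.refl G)
      map_mul' := fun _ _ => rfl }
  map_one' := by ext f x; rfl
  map_mul' := by intro σ τ; ext f x; rfl

/-- The wreath product `G(n) = G ≀ S(n) = Gⁿ ⋊ S(n)`. -/
def Wreath (G : Type*) [Group G] (n : ℕ) : Type _ :=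
  (Fin n → G) ⋊[permAction G n] Equiv.Perm (Fin n)

instance (G : Type*) [Group G] (n : ℕ) : Group (Wreath G n) :=
  inferInstanceAs (Group ((Fin n → G) ⋊[permAction G n] Equiv.Perm (Fin n)))

/-- `g^{(i)} ∈ G(n)`: the element of the subgroup `Gⁿ` with `g` in coordinate `i`
and the identity elsewhere. -/
def gEl {G : Type*} [Group G] {n : ℕ} (i : Fin n) (g : G) : Wreath G n :=
  SemidirectProduct.inl (Pi.mulSingle i g)

/-- The image in `G(n)` of the cyclic permutation `(i₁, …, i_k)`
(`i₁ → i₂ → ⋯ → i_k → i₁`), the tuple being given by an embedding. -/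
def cycW {G : Type*} [Group G] {n : ℕ} {k : ℕ} (t : Fin k ↪ Fin n) : Wreath G n :=
  SemidirectProduct.inr (List.ofFn fun a => t a).formPerm

/-- `z = Σ φ(g_k ⋯ g₁) g₁^{(i₁)} ⋯ g_k^{(i_k)} (i₁,…,i_k) ∈ ℂ[G(n)]`, summed over
all ordered k-tuples of pairwise distinct indices `i₁,…,i_k ∈ {1,…,n}` and all
k-tuples `g₁,…,g_k ∈ G`. -/
noncomputable def zEl (G : Type*) [Group G] [Fintype G] (φ : G → ℂ) (k n : ℕ) :
    MonoidAlgebra ℂ (Wreath G n) :=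
  ∑ t : Fin k ↪ Fin n, ∑ gs : Fin k → G,
    φ ((List.ofFn gs).reverse.prod) •
      MonoidAlgebra.of ℂ (Wreath G n)
        ((List.ofFn fun a : Fin k => gEl (t a) (gs a)).prod * cycW t)

namespace Wreath

variable {G : Type*} [Group G] {n : ℕ}

/-- The inclusion of the base group `Gⁿ`. -/
def base : (Fin n → G) →* Wreath G n :=
  (SemidirectProduct.inl : _ →* (Fin n → G) ⋊[permAction G n] Equiv.Perm (Fin n))

/-- The inclusion of `S(n)`. -/
def perm : Equiv.Perm (Fin n) →* Wreath G n :=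
  (SemidirectProduct.inr : _ →* (Fin n → G) ⋊[permAction G n] Equiv.Perm (Fin n))

theorem perm_mul_base (σ : Equiv.Perm (Fin n)) (f : Fin n → G) :
    perm σ * base f = base (f ∘ σ.symm) * perm σ := by
  have h := SemidirectProduct.inl_aut (φ := permAction G n) σ f
  have h' : base (f ∘ σ.symm) = perm σ * base f * perm σ⁻¹ := h
  rw [h', mul_assoc, ← map_mul, inv_mul_cancel, map_one, mul_one]

theorem exists_eq_base_mul_perm (u : Wreath G n) : ∃ f σ, u = base f * perm σ :=
  ⟨u.left, u.right, (SemidirectProduct.inl_left_mul_inr_right u).symm⟩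

theorem prod_mulSingle_eq_extend {k : ℕ} (t : Fin k → Fin n) (ht : t.Injective)
    (gs : Fin k → G) :
    (List.ofFn fun a => (Pi.mulSingle (t a) (gs a) : Fin n → G)).prod
      = Function.extend t gs 1 := by
  induction k with
  | zero =>
    funext x
    rw [Function.extend_apply' _ _ _ (by rintro ⟨a, -⟩; exact a.elim0)]
    simp
  | succ k ih =>
    have ht' : (fun a : Fin k => t a.succ).Injective :=
      ht.comp (Fin.succ_injective k)
    rw [List.ofFn_succ, List.prod_cons, ih (fun a => t a.succ) ht' fun a => gs a.succ]
    funext x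
    rw [Pi.mul_apply]
    by_cases hx : ∃ a, t a = x
    · obtain ⟨a, rfl⟩ := hx
      rw [ht.extend_apply]
      cases a using Fin.cases with
      | zero =>
        rw [Function.extend_apply' _ _ _ (by
          rintro ⟨a, ha⟩; exact Fin.succ_ne_zero a (ht ha))]
        simp
      | succ a =>
        rw [ht'.extend_apply (fun a => gs a.succ) 1 a,
          Pi.mulSingle_eq_of_ne (ht.ne (Fin.succ_ne_zero a)), one_mul]
    · rw [Function.extend_apply' _ _ _ hx, Function.extend_apply' _ _ _
        (fun ⟨a, ha⟩ => hx ⟨_, ha⟩),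
        Pi.mulSingle_eq_of_ne (fun h => hx ⟨0, h.symm⟩)]
      simp

theorem prod_gEl_mul_cycW {k : ℕ} (t : Fin k ↪ Fin n) (gs : Fin k → G) :
    (List.ofFn fun a : Fin k => gEl (t a) (gs a)).prod * cycW t
      = base (Function.extend t gs 1) * perm (List.ofFn t).formPerm := by
  rw [← prod_mulSingle_eq_extend t t.injective gs, map_list_prod, List.map_ofFn]
  rfl

theorem formPerm_ofFn_apply {m : ℕ} (t : Fin (m + 1) ↪ Fin n) (a : Fin (m + 1)) :
    (List.ofFn t).formPerm (t a) = t (a + 1) := by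
  have h := List.formPerm_apply_getElem (List.ofFn t) (List.nodup_ofFn.2 t.injective) a
    (by simp only [List.length_ofFn, a.isLt])
  simp only [List.getElem_ofFn, List.length_ofFn, Fin.eta] at h
  rw [h]
  congr 1
  ext
  simp [Fin.val_add]

theorem formPerm_ofFn_of_notMem {k : ℕ} (t : Fin k ↪ Fin n) {x : Fin n}
    (hx : ¬ ∃ a, t a = x) : (List.ofFn t).formPerm x = x :=
  List.formPerm_apply_of_notMem (by simpa [List.mem_ofFn] using hx)

theorem formPerm_ofFn_trans {m : ℕ} (t : Fin (m + 1) ↪ Fin n) (σ : Equiv.Perm (Fin n)) :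
    (List.ofFn (t.trans σ.toEmbedding)).formPerm * σ = σ * (List.ofFn t).formPerm := by
  ext1 x
  simp only [Equiv.Perm.mul_apply]
  by_cases hx : ∃ a, t a = x
  · obtain ⟨a, rfl⟩ := hx
    rw [formPerm_ofFn_apply]
    exact formPerm_ofFn_apply (t.trans σ.toEmbedding) a
  · rw [formPerm_ofFn_of_notMem t hx, formPerm_ofFn_of_notMem]
    simpa using hx

theorem perm_mul_cycle {m : ℕ} (σ : Equiv.Perm (Fin n)) (t : Fin (m + 1) ↪ Fin n)
    (gs : Fin (m + 1) → G) :
    perm σ * ((List.ofFn fun a => gEl (t a) (gs a)).prod * cycW t)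
      = ((List.ofFn fun a => gEl (t.trans σ.toEmbedding a) (gs a)).prod *
          cycW (t.trans σ.toEmbedding)) * perm σ := by
  rw [prod_gEl_mul_cycW, prod_gEl_mul_cycW, ← mul_assoc, perm_mul_base, mul_assoc, mul_assoc,
    ← map_mul, ← map_mul, formPerm_ofFn_trans]
  congr 2
  funext x
  by_cases hx : ∃ a, t a = σ.symm x
  · obtain ⟨a, ha⟩ := hx
    obtain rfl : (t.trans σ.toEmbedding) a = x := by simp [ha]
    rw [Function.Embedding.injective _ |>.extend_apply, Function.comp_apply, ← ha,
      t.injective.extend_apply]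
  · rw [Function.comp_apply, Function.extend_apply' _ _ _ hx, Function.extend_apply']
    · rfl
    · rintro ⟨a, rfl⟩
      exact hx ⟨a, by simp⟩

theorem base_mul_cycle {m : ℕ} (f : Fin n → G) (t : Fin (m + 1) ↪ Fin n)
    (gs : Fin (m + 1) → G) :
    base f * ((List.ofFn fun a => gEl (t a) (gs a)).prod * cycW t)
      = ((List.ofFn fun a => gEl (t a) (f (t a) * gs a * (f (t (a - 1)))⁻¹)).prod * cycW t) *
          base f := by
  rw [prod_gEl_mul_cycW, prod_gEl_mul_cycW t fun a => f (t a) * gs a * (f (t (a - 1)))⁻¹,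
    mul_assoc, perm_mul_base, ← mul_assoc, ← mul_assoc, ← map_mul, ← map_mul]
  congr 2
  funext x
  simp only [Pi.mul_apply, Function.comp_apply]
  by_cases hx : ∃ a, t a = x
  · obtain ⟨a, rfl⟩ := hx
    have h : (List.ofFn t).formPerm.symm (t a) = t (a - 1) := by
      rw [Equiv.symm_apply_eq, formPerm_ofFn_apply, sub_add_cancel]
    rw [t.injective.extend_apply, t.injective.extend_apply, h, inv_mul_cancel_right]
  · have h : (List.ofFn t).formPerm.symm x = x := by
      rw [Equiv.symm_apply_eq, formPerm_ofFn_of_notMem t hx]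
    rw [Function.extend_apply' _ _ _ hx, Function.extend_apply' _ _ _ hx, h]
    simp

theorem prod_reverse_ofFn_telescope {k : ℕ} (q : Fin (k + 1) → G) (g : Fin k → G) :
    (List.ofFn fun a => q a.succ * g a * (q a.castSucc)⁻¹).reverse.prod
      = q (Fin.last k) * (List.ofFn g).reverse.prod * (q 0)⁻¹ := by
  induction k with
  | zero => simp
  | succ k ih =>
    have h := ih (fun a => q a.succ) fun a => g a.succ
    simp only [Fin.succ_castSucc, Fin.succ_last] at h
    simp only [List.ofFn_succ, List.reverse_cons, List.prod_append, List.prod_singleton]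
    rw [h]
    simp [mul_assoc]

theorem prod_reverse_ofFn_cyclic {m : ℕ} (p g : Fin (m + 1) → G) :
    (List.ofFn fun a => p a * g a * (p (a - 1))⁻¹).reverse.prod
      = p (Fin.last m) * (List.ofFn g).reverse.prod * (p (Fin.last m))⁻¹ := by
  have h := prod_reverse_ofFn_telescope (Fin.cons (p (Fin.last m)) p : Fin (m + 2) → G) g
  rw [← Fin.succ_last, Fin.cons_succ, Fin.cons_zero] at h
  rw [← h]
  congr 3
  funext a
  rw [Fin.cons_succ]
  congr 2
  cases a using Fin.cases with
  | zero =>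
    rw [Fin.castSucc_zero, Fin.cons_zero]
    congr 1
    rw [sub_eq_iff_eq_add]
    simp
  | succ b =>
    rw [← Fin.succ_castSucc, Fin.cons_succ]
    congr 1
    rw [sub_eq_iff_eq_add, Fin.coeSucc_eq_succ]

variable [Fintype G]

theorem perm_commute_zEl (φ : G → ℂ) (m : ℕ) (σ : Equiv.Perm (Fin n)) :
    Commute (MonoidAlgebra.of ℂ (Wreath G n) (perm σ)) (zEl G φ (m + 1) n) := by
  rw [Commute, SemiconjBy, zEl, Finset.mul_sum, Finset.sum_mul]
  refine Fintype.sum_equiv (Equiv.embeddingCongr (Equiv.refl _) σ) _ _ fun t => ?_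
  rw [Finset.mul_sum, Finset.sum_mul]
  refine Finset.sum_congr rfl fun gs _ => ?_
  rw [mul_smul_comm, smul_mul_assoc, ← map_mul, ← map_mul, perm_mul_cycle]
  rfl

theorem base_commute_zEl (φ : G → ℂ) (hφ : ∀ a b : G, φ (a * b * a⁻¹) = φ b) (m : ℕ)
    (f : Fin n → G) :
    Commute (MonoidAlgebra.of ℂ (Wreath G n) (base f)) (zEl G φ (m + 1) n) := by
  rw [Commute, SemiconjBy, zEl, Finset.mul_sum, Finset.sum_mul]
  refine Finset.sum_congr rfl fun t _ => ?_
  rw [Finset.mul_sum, Finset.sum_mul]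
  refine Fintype.sum_equiv (Equiv.piCongrRight fun a =>
    (Equiv.mulLeft (f (t a))).trans (Equiv.mulRight (f (t (a - 1)))⁻¹)) _ _ fun gs => ?_
  rw [mul_smul_comm, smul_mul_assoc, ← map_mul, ← map_mul, base_mul_cycle,
    ← hφ (f (t (Fin.last m))), ← prod_reverse_ofFn_cyclic (fun a => f (t a)) gs]
  rfl

end Wreath

theorem stmt11 (G : Type*) [Group G] [Fintype G] (φ : G → ℂ)
    (hφ : ∀ a b : G, φ (a * b * a⁻¹) = φ b) (k n : ℕ) (hk : 1 ≤ k) (hkn : k ≤ n) :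
    zEl G φ k n ∈ Subring.center (MonoidAlgebra ℂ (Wreath G n)) := by
  obtain ⟨m, rfl⟩ : ∃ m, k = m + 1 := ⟨k - 1, by omega⟩
  rw [Subring.mem_center_iff]
  intro x
  induction x using MonoidAlgebra.induction_on with
  | of u =>
    obtain ⟨f, σ, rfl⟩ := Wreath.exists_eq_base_mul_perm u
    rw [map_mul]
    exact (Wreath.base_commute_zEl φ hφ m f).mul_left (Wreath.perm_commute_zEl φ m σ)
  | add x y hx hy => rw [add_mul, mul_add, hx, hy]
  | smul r x hx => rw [smul_mul_assoc, mul_smul_comm, hx]
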